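/- For n ≥ 1, the number of weakly increasing prime parking functions of length n is the Catalan number C_{n-1} = (1/n)·C(2(n-1), n-1). -/

import Mathlib

/-- `#{j : a j ≤ t}`. -/
def countLe {n : ℕ} (a : Fin n → ℕ) (t : ℕ) : ℕ :=
  (Finset.univ.filter fun j => a j ≤ t).card

/-- `a` is a prime parking function of length `n`:
`#{j : a j ≤ i} ≥ i + 1` for `i = 0, …, n-1` and `#{j : a j ≤ i} > i + 1` for
`i = 0, …, n-2`. -/
def IsPrimeParkingFunction {n : ℕ} (a : Fin n → ℕ) : Prop :=
  (∀ i : ℕ, i < n → i + 1 ≤ countLe a i) ∧ ∀ i : ℕ, i + 1 < n → i + 1 < countLe a i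

lemma lt_countLe_iff {n : ℕ} {a : Fin n → ℕ} (ha : Monotone a) (s : Fin n) (t : ℕ) :
    (s : ℕ) < countLe a t ↔ a s ≤ t := by
  unfold countLe
  constructor
  · intro h
    by_contra hc
    have hsub : (Finset.univ.filter fun j => a j ≤ t) ⊆ Finset.Iio s := by
      intro j hj
      simp only [Finset.mem_filter, Finset.mem_univ, true_and] at hj
      rw [Finset.mem_Iio]
      by_contra hjs
      have := ha (not_lt.mp hjs)
      omega
    have := Finset.card_le_card hsub
    rw [Fin.card_Iio] at this
    omega
  · intro h
    have hsub : Finset.Iic s ⊆ (Finset.univ.filter fun j => a j ≤ t) := by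
      intro j hj
      simp only [Finset.mem_filter, Finset.mem_univ, true_and]
      exact (ha (Finset.mem_Iic.mp hj)).trans h
    have := Finset.card_le_card hsub
    rw [Fin.card_Iic] at this
    omega

/-- Monotone sequences below the staircase and below `k`. -/
def stair (m k : ℕ) : Set (Fin (m + 1) → ℕ) :=
  {a | Monotone a ∧ ∀ j, a j ≤ (j : ℕ) - 1 ∧ a j ≤ k}

lemma stair_finite (m k : ℕ) : (stair m k).Finite :=
  (Set.finite_Iic (fun _ : Fin (m + 1) => k)).subset fun _ ha j => (ha.2 j).2

lemma stair_zero (m : ℕ) : (stair m 0).ncard = 1 := by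
  rw [Set.ncard_eq_one]
  refine ⟨0, Set.ext fun a => ⟨fun h => ?_, ?_⟩⟩
  · rw [Set.mem_singleton_iff]
    funext j
    have := (h.2 j).2
    simpa using this
  · rintro rfl
    exact ⟨fun _ _ _ => le_rfl, fun j => ⟨Nat.zero_le _, le_rfl⟩⟩

lemma stair_diag (m : ℕ) : stair (m + 1) (m + 1) = stair (m + 1) m := by
  ext a
  constructor
  · rintro ⟨h, h2⟩
    refine ⟨h, fun j => ⟨(h2 j).1, ?_⟩⟩
    have := (h2 j).1
    have := j.2
    omega
  · rintro ⟨h, h2⟩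
    exact ⟨h, fun j => ⟨(h2 j).1, (h2 j).2.trans (Nat.le_succ m)⟩⟩

lemma stair_union (m k : ℕ) (hk : k + 1 ≤ m) :
    stair (m + 1) (k + 1) = stair (m + 1) k ∪
      Set.image (fun b : Fin (m + 1) → ℕ => (Fin.snoc b (k + 1) : Fin (m + 2) → ℕ))
        (stair m (k + 1)) := by
  ext a
  constructor
  · rintro ⟨h, h2⟩
    by_cases hl : a (Fin.last _) ≤ k
    · exact Or.inl ⟨h, fun j => ⟨(h2 j).1, (h (Fin.le_last j)).trans hl⟩⟩
    · right
      refine ⟨Fin.init a, ⟨fun i j hij => h (Fin.castSucc_le_castSucc_iff.mpr hij),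
        fun j => h2 j.castSucc⟩, ?_⟩
      have : k + 1 = a (Fin.last _) := by
        have := (h2 (Fin.last _)).2
        omega
      simp only [this]
      exact Fin.snoc_init_self a
  · rintro (⟨h, h2⟩ | ⟨b, ⟨h, h2⟩, rfl⟩)
    · exact ⟨h, fun j => ⟨(h2 j).1, (h2 j).2.trans (Nat.le_succ k)⟩⟩
    · refine ⟨?_, ?_⟩
      · intro i j hij
        induction j using Fin.lastCases with
        | last =>
          induction i using Fin.lastCases with
          | last => exact le_rfl
          | cast i => simpa using (h2 i).2
        | cast j =>
          induction i using Fin.lastCases with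
          | last => exact absurd hij (not_le.mpr (Fin.castSucc_lt_last j))
          | cast i => simpa using h (Fin.castSucc_le_castSucc_iff.mp hij)
      · intro j
        induction j using Fin.lastCases with
        | last => simpa using hk
        | cast j => simpa using h2 j

lemma stair_rec (m k : ℕ) (hk : k + 1 ≤ m) :
    (stair (m + 1) (k + 1)).ncard = (stair (m + 1) k).ncard + (stair m (k + 1)).ncard := by
  rw [stair_union m k hk, Set.ncard_union_eq ?_ (stair_finite _ _) ((stair_finite _ _).image _),
    Set.ncard_image_of_injective]
  · intro b c hbc
    have := congrArg Fin.init hbc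
    simpa using this
  · rw [Set.disjoint_left]
    rintro _ ⟨_, h2⟩ ⟨b, _, rfl⟩
    have := (h2 (Fin.last _)).2
    simp at this

lemma stair_card (m : ℕ) : ∀ k ≤ m,
    (stair m k).ncard + (m + k).choose (m + 1) = (m + k).choose m := by
  induction m with
  | zero =>
    intro k hk
    obtain rfl : k = 0 := by omega
    simp [stair_zero]
  | succ m ihm =>
    intro k
    induction k with
    | zero => intro _; simp [stair_zero]
    | succ k ihk =>
      intro hk
      have h1 := ihk (by omega)
      have e : m + 1 + (k + 1) = (m + 1 + k) + 1 := by ring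
      rw [e, Nat.choose_succ_succ (m + 1 + k) (m + 1), Nat.choose_succ_succ (m + 1 + k) m]
      simp only [Nat.succ_eq_add_one] at *
      rcases Nat.lt_or_ge k m with hkm | hkm
      · have h2 := ihm (k + 1) hkm
        rw [stair_rec m k hkm]
        have e2 : m + (k + 1) = m + 1 + k := by ring
        rw [e2] at h2
        omega
      · obtain rfl : k = m := by omega
        rw [stair_diag]
        have h3 := Nat.choose_symm_half k
        have e3 : k + 1 + k = 2 * k + 1 := by ring
        rw [e3] at h1 ⊢
        omega

lemma ppf_eq_stair (m : ℕ) :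
    {a : Fin (m + 1) → ℕ | Monotone a ∧ IsPrimeParkingFunction a} = stair m m := by
  ext a
  constructor
  · rintro ⟨h, h1, h2⟩
    have key : ∀ j : Fin (m + 1), a j ≤ (j : ℕ) - 1 := by
      intro j
      rw [← lt_countLe_iff h]
      rcases Nat.eq_zero_or_pos (j : ℕ) with hj | hj
      · have := h1 0 (by omega)
        rw [hj]
        exact this
      · have := h2 ((j : ℕ) - 1) (by omega)
        omega
    exact ⟨h, fun j => ⟨key j, by have := key j; omega⟩⟩
  · rintro ⟨h, h2⟩
    refine ⟨h, fun i hi => ?_, fun i hi => ?_⟩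
    · have := (lt_countLe_iff h ⟨i, hi⟩ i).mpr ((h2 ⟨i, hi⟩).1.trans (Nat.sub_le _ _))
      exact this
    · exact (lt_countLe_iff h ⟨i + 1, hi⟩ i).mpr (h2 ⟨i + 1, hi⟩).1

/-- For `n ≥ 1`, the number of weakly increasing prime parking functions of length `n`
is the Catalan number `C_{n-1} = (1/n) C(2(n-1), n-1)`. -/
theorem stmt6 (n : ℕ) (hn : 1 ≤ n) :
    (({a : Fin n → ℕ | Monotone a ∧ IsPrimeParkingFunction a}.ncard : ℚ))
      = (1 / n) * ((2 * (n - 1)).choose (n - 1)) := by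
  obtain ⟨m, rfl⟩ : ∃ m, n = m + 1 := ⟨n - 1, by omega⟩
  rw [ppf_eq_stair]
  have h := stair_card m m le_rfl
  have h2 := Nat.choose_succ_right_eq (m + m) m
  rw [Nat.add_sub_cancel] at h2
  rw [Nat.add_sub_cancel, two_mul]
  have hq : ((stair m m).ncard : ℚ) + ((m + m).choose (m + 1) : ℕ) = ((m + m).choose m : ℕ) := by
    exact_mod_cast h
  have hq2 : (((m + m).choose (m + 1) : ℕ) : ℚ) * (m + 1) = ((m + m).choose m : ℕ) * m := by
    exact_mod_cast h2
  have hm : (m : ℚ) + 1 ≠ 0 := by positivity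
  push_cast
  field_simp
  linear_combination (m + 1 : ℚ) * hq - hq2
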